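/- For every target t ∈ T, the activation probability function p_t(m) is DR-submodular on (S → ℕ): for all m ≤ m′ (coordinatewise) and all e ∈ S, p_t(m + χ_e) − p_t(m) ≥ p_t(m′ + χ_e) − p_t(m′). -/

import Mathlib

open Finset

/-- Activation probability of target `t` under strategy `m`:
`p_t(m) = 1 - ∏_{s ∈ Γ(t)} ∏_{i=1}^{m(s)} (1 - p_s^i)`. -/
noncomputable def activationProb {S T : Type*} (Γ : T → Finset S) (p : S → ℕ → ℝ)
    (t : T) (m : S → ℕ) : ℝ :=
  1 - ∏ s ∈ Γ t, ∏ i ∈ Finset.Icc 1 (m s), (1 - p s i)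

/-- The marginal gain of one more trial of `e` is the probability that this trial succeeds
while all trials in `m` fail. -/
theorem activationProb_add_single_sub {S T : Type*} [DecidableEq S]
    (Γ : T → Finset S) (p : S → ℕ → ℝ) (t : T) (m : S → ℕ) (e : S) :
    activationProb Γ p t (m + Pi.single e 1) - activationProb Γ p t m =
      if e ∈ Γ t then p e (m e + 1) * ∏ s ∈ Γ t, ∏ i ∈ Finset.Icc 1 (m s), (1 - p s i)
      else 0 := by
  have hprod : ∀ s, ∏ i ∈ Finset.Icc 1 ((m + Pi.single e 1 : S → ℕ) s), (1 - p s i) =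
      (∏ i ∈ Finset.Icc 1 (m s), (1 - p s i)) * if s = e then 1 - p e (m e + 1) else 1 := by
    intro s
    by_cases h : s = e
    · subst h
      simp [Finset.prod_Icc_succ_top]
    · simp [h]
  simp only [activationProb, hprod, Finset.prod_mul_distrib, Finset.prod_ite_eq']
  split_ifs <;> ring

/-- For every target `t`, the activation probability `p_t` is DR-submodular on `S → ℕ`. -/
theorem activationProb_DRSubmodular {S T : Type*} [Fintype S] [Fintype T] [DecidableEq S]
    (Γ : T → Finset S) (p : S → ℕ → ℝ)
    (hp0 : ∀ s i, 0 ≤ p s i) (hp1 : ∀ s i, p s i ≤ 1)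
    (hpmono : ∀ s i j, 1 ≤ j → j ≤ i → p s i ≤ p s j) :
    ∀ t : T, ∀ m m' : S → ℕ, m ≤ m' → ∀ e : S,
      activationProb Γ p t (m + Pi.single e 1) - activationProb Γ p t m ≥
        activationProb Γ p t (m' + Pi.single e 1) - activationProb Γ p t m' := by
  intro t m m' hm e
  have hnonneg : ∀ (n : S → ℕ) (s : S), 0 ≤ ∏ i ∈ Finset.Icc 1 (n s), (1 - p s i) :=
    fun n s => Finset.prod_nonneg fun i _ => sub_nonneg.2 (hp1 s i)
  rw [ge_iff_le, activationProb_add_single_sub, activationProb_add_single_sub]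
  split_ifs
  · refine mul_le_mul (hpmono e _ _ (Nat.le_add_left 1 _) (Nat.succ_le_succ (hm e)))
      (Finset.prod_le_prod (fun s _ => hnonneg m' s) fun s _ => ?_)
      (Finset.prod_nonneg fun s _ => hnonneg m' s) (hp0 e _)
    exact Finset.prod_le_prod_of_subset_of_le_one (Finset.Icc_subset_Icc_right (hm s))
      (fun i _ => sub_nonneg.2 (hp1 s i)) (fun i _ _ => sub_le_self 1 (hp0 s i))
  · exact le_rfl
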